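/- Let ν > 0, let ū, u' : ℝ² → ℝ² be smooth vector fields with ū having bounded derivatives and u' bounded, let u := ū + u', and let φ : ℝ² → ℝ be smooth with compact support. Define the pointwise symmetric 2×2 matrix field Λ(x) := −∇_S ū(x) + ½ (∇·ū)(x) I₂ + (1/(2ν)) u'(x) u'(x)ᵀ, where ∇_S ū := ½(∇ū + (∇ū)ᵀ), ∇·ū is the divergence of ū, I₂ the 2×2 identity matrix, and u'u'ᵀ the outer product. Then ∫_{ℝ²} (u·∇φ) Δφ dx ≤ ∫_{ℝ²} (Λ(x) ∇φ(x)) · ∇φ(x) dx + (ν/2) ∫_{ℝ²} (Δφ)² dx. -/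

import Mathlib

open MeasureTheory Matrix Set

noncomputable section

/-- The plane `ℝ²` with the Euclidean structure. -/
abbrev E2 := EuclideanSpace ℝ (Fin 2)

/-- Partial derivative `∂ᵢ f` of a scalar function on `ℝ²`. -/
def pd (i : Fin 2) (f : E2 → ℝ) (x : E2) : ℝ :=
  fderiv ℝ f x (EuclideanSpace.single i 1)

/-- The Laplacian `Δ f = ∂₁∂₁ f + ∂₂∂₂ f`. -/
def lap (f : E2 → ℝ) (x : E2) : ℝ :=
  pd 0 (pd 0 f) x + pd 1 (pd 1 f) x

/-- The rotated gradient `rot ψ = (∂₂ψ, −∂₁ψ)`. -/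
def rotv (f : E2 → ℝ) (x : E2) : Fin 2 → ℝ := ![pd 1 f x, -(pd 0 f x)]

/-- The gradient `∇f = (∂₁f, ∂₂f)` as a plain vector. -/
def grad2 (f : E2 → ℝ) (x : E2) : Fin 2 → ℝ := ![pd 0 f x, pd 1 f x]

/-- The Jacobian matrix `(∇u)ᵢⱼ = ∂ⱼ uᵢ` of a vector field. -/
def gradMat (u : E2 → Fin 2 → ℝ) (x : E2) : Matrix (Fin 2) (Fin 2) ℝ :=
  Matrix.of fun i j => pd j (fun y => u y i) x

/-- The divergence `∇·u = ∂₁u₁ + ∂₂u₂` of a vector field. -/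
def divg (u : E2 → Fin 2 → ℝ) (x : E2) : ℝ :=
  pd 0 (fun y => u y 0) x + pd 1 (fun y => u y 1) x

/-- Partial derivatives of smooth functions are smooth. -/
theorem contDiff_pd {f : E2 → ℝ} (hf : ContDiff ℝ (⊤ : ℕ∞) f) (i : Fin 2) :
    ContDiff ℝ (⊤ : ℕ∞) (pd i f) :=
  (hf.fderiv_right (m := (⊤ : ℕ∞)) (by simp)).clm_apply contDiff_const

theorem pd_mul {f g : E2 → ℝ} (hf : ContDiff ℝ (⊤ : ℕ∞) f) (hg : ContDiff ℝ (⊤ : ℕ∞) g)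
    (i : Fin 2) (x : E2) :
    pd i (fun y => f y * g y) x = pd i f x * g x + f x * pd i g x := by
  have h := ((hf.differentiable (by simp)) x).hasFDerivAt.mul
    ((hg.differentiable (by simp)) x).hasFDerivAt
  have h' : fderiv ℝ (fun y => f y * g y) x = _ := h.fderiv
  simp only [pd, h', _root_.add_apply, _root_.smul_apply, smul_eq_mul]
  ring

theorem pd_add {f g : E2 → ℝ} (hf : ContDiff ℝ (⊤ : ℕ∞) f) (hg : ContDiff ℝ (⊤ : ℕ∞) g)
    (i : Fin 2) (x : E2) :
    pd i (fun y => f y + g y) x = pd i f x + pd i g x := by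
  have h := ((hf.differentiable (by simp)) x).hasFDerivAt.add
    ((hg.differentiable (by simp)) x).hasFDerivAt
  have h' : fderiv ℝ (fun y => f y + g y) x = _ := h.fderiv
  simp only [pd, h', _root_.add_apply]

theorem pd_const (c : ℝ) (i : Fin 2) (x : E2) : pd i (fun _ => c) x = 0 := by
  simp [pd]

/-- Mixed partial derivatives of a smooth function commute. -/
theorem pd_comm {f : E2 → ℝ} (hf : ContDiff ℝ (⊤ : ℕ∞) f) (i j : Fin 2) (x : E2) :
    pd i (pd j f) x = pd j (pd i f) x := by
  have hd : DifferentiableAt ℝ (fderiv ℝ f) x :=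
    (hf.fderiv_right (m := (⊤ : ℕ∞)) (by simp)).differentiable (by simp) x
  have key (k l : Fin 2) : pd k (pd l f) x =
      fderiv ℝ (fderiv ℝ f) x (EuclideanSpace.single k 1) (EuclideanSpace.single l 1) := by
    have h := hd.hasFDerivAt.clm_apply
      (hasFDerivAt_const (EuclideanSpace.single l (1 : ℝ) : E2) x)
    have h' : fderiv ℝ (pd l f) x = _ := h.fderiv
    rw [pd, h']
    simp
  rw [key, key]
  exact (hf.contDiffAt.isSymmSndFDerivAt
    (by simp only [minSmoothness_of_isRCLikeNormedField]; exact WithTop.coe_le_coe.2 (le_top (a := (2 : ℕ∞))))).eq _ _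

theorem pd_eq_zero_of_notMem_tsupport {f : E2 → ℝ} {x : E2} (hx : x ∉ tsupport f) (i : Fin 2) :
    pd i f x = 0 := by
  rw [pd, image_eq_zero_of_notMem_tsupport fun h => hx (tsupport_fderiv_subset ℝ h)]
  rfl

theorem tsupport_pd_subset (f : E2 → ℝ) (i : Fin 2) : tsupport (pd i f) ⊆ tsupport f :=
  closure_minimal
    (fun _ hx => by_contra fun h => hx (pd_eq_zero_of_notMem_tsupport h i))
    (isClosed_tsupport f)

/-- The partial derivatives of a smooth compactly supported function integrate to zero. -/
theorem integral_pd_eq_zero {f : E2 → ℝ} (hf : ContDiff ℝ (⊤ : ℕ∞) f)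
    (hs : HasCompactSupport f) (i : Fin 2) : Integrable (pd i f) ∧ ∫ x, pd i f x = 0 := by
  have hi : Integrable (pd i f) := (contDiff_pd hf i).continuous.integrable_of_hasCompactSupport
    (hs.fderiv_apply ℝ _)
  refine ⟨hi, ?_⟩
  have h := integral_mul_fderiv_eq_neg_fderiv_mul_of_integrable (𝕜 := ℝ)
    (μ := (volume : Measure E2)) (f := fun _ => (1 : ℝ)) (g := f)
    (v := EuclideanSpace.single i 1) (by simp) (by simpa [pd] using! hi)
    (by simpa using hf.continuous.integrable_of_hasCompactSupport hs)
    (fun _ _ => differentiableAt_const _) (fun _ _ => hf.differentiable (by simp) _)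
  simpa [pd] using h

/-- bound on the convective term by the quadratic form of the stability
matrix `Λ = −∇_S ū + ½(∇·ū)I₂ + (1/(2ν)) u'u'ᵀ` plus the viscous term. -/
theorem convective_term_bound (ν : ℝ) (hν : 0 < ν)
    (ub u' : E2 → Fin 2 → ℝ)
    (hub : ContDiff ℝ (⊤ : ℕ∞) ub) (hu' : ContDiff ℝ (⊤ : ℕ∞) u')
    (hubD : ∃ C, ∀ (x : E2) (i j : Fin 2), |gradMat ub x i j| ≤ C)
    (hu'b : ∃ C, ∀ (x : E2) (i : Fin 2), |u' x i| ≤ C)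
    (u : E2 → Fin 2 → ℝ) (hu : ∀ x, u x = ub x + u' x)
    (φ : E2 → ℝ) (hφ : ContDiff ℝ (⊤ : ℕ∞) φ) (hsupp : HasCompactSupport φ)
    (Λ : E2 → Matrix (Fin 2) (Fin 2) ℝ)
    (hΛ : ∀ x, Λ x = -(((1 : ℝ) / 2) • (gradMat ub x + (gradMat ub x)ᵀ))
        + (((1 : ℝ) / 2) * divg ub x) • (1 : Matrix (Fin 2) (Fin 2) ℝ)
        + (1 / (2 * ν)) • Matrix.vecMulVec (u' x) (u' x)) :
    ∫ x : E2, (∑ i, u x i * pd i φ x) * lap φ x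
      ≤ (∫ x : E2, ((Λ x).mulVec (grad2 φ x)) ⬝ᵥ grad2 φ x)
        + (ν / 2) * ∫ x : E2, (lap φ x) ^ 2 := by
  have hint {f : E2 → ℝ} (hf : Continuous f) (h0 : ∀ x ∉ tsupport φ, f x = 0) :
      Integrable f :=
    hf.integrable_of_hasCompactSupport (HasCompactSupport.intro hsupp h0)
  have hb (i : Fin 2) : ContDiff ℝ (⊤ : ℕ∞) fun x => ub x i := contDiff_pi.1 hub i
  have hv (i : Fin 2) : Continuous fun x => u' x i := (contDiff_pi.1 hu' i).continuous
  have hp (i : Fin 2) := contDiff_pd hφ i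
  have hbc (i : Fin 2) := (hb i).continuous
  have hpc (i : Fin 2) := (hp i).continuous
  have hbd (i j : Fin 2) := (contDiff_pd (hb i) j).continuous
  have hpd (i j : Fin 2) := (contDiff_pd (hp i) j).continuous
  have hlap : Continuous (lap φ) := (hpd 0 0).add (hpd 1 1)
  have hp0 {x : E2} (hx : x ∉ tsupport φ) (i : Fin 2) : pd i φ x = 0 :=
    pd_eq_zero_of_notMem_tsupport hx i
  have hlap0 {x : E2} (hx : x ∉ tsupport φ) : lap φ x = 0 := by
    have h (i : Fin 2) : pd i (pd i φ) x = 0 :=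
      pd_eq_zero_of_notMem_tsupport (fun h => hx (tsupport_pd_subset φ i h)) i
    simp [lap, h]
  -- The components of the flux `(ū·∇φ)∇φ - ½|∇φ|²ū`, which has vanishing total divergence.
  let F : Fin 2 → E2 → ℝ := fun i x =>
    (ub x 0 * pd 0 φ x + ub x 1 * pd 1 φ x) * pd i φ x
      + (-1 / 2) * (ub x i * (pd 0 φ x * pd 0 φ x + pd 1 φ x * pd 1 φ x))
  have hF (i : Fin 2) : ContDiff ℝ (⊤ : ℕ∞) (F i) :=
    ((((hb 0).mul (hp 0)).add ((hb 1).mul (hp 1))).mul (hp i)).add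
      (contDiff_const.mul ((hb i).mul (((hp 0).mul (hp 0)).add ((hp 1).mul (hp 1)))))
  have hFi (i : Fin 2) := integral_pd_eq_zero (hF i)
    (HasCompactSupport.intro hsupp fun x hx => by simp [F, hp0 hx]) i
  have hpdF (i : Fin 2) (x : E2) : pd i (F i) x =
      (pd i (fun y => ub y 0) x * pd 0 φ x + ub x 0 * pd i (pd 0 φ) x
        + (pd i (fun y => ub y 1) x * pd 1 φ x + ub x 1 * pd i (pd 1 φ) x)) * pd i φ x
      + (ub x 0 * pd 0 φ x + ub x 1 * pd 1 φ x) * pd i (pd i φ) x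
      + (-1 / 2) * (pd i (fun y => ub y i) x * (pd 0 φ x * pd 0 φ x + pd 1 φ x * pd 1 φ x)
        + ub x i * (2 * pd 0 φ x * pd i (pd 0 φ) x + 2 * pd 1 φ x * pd i (pd 1 φ) x)) := by
    have hA := ((hb 0).mul (hp 0)).add ((hb 1).mul (hp 1))
    have hS := ((hp 0).mul (hp 0)).add ((hp 1).mul (hp 1))
    simp only [F]
    rw [pd_add (hA.mul (hp i)) (contDiff_const.mul ((hb i).mul hS)), pd_mul hA (hp i),
      pd_add ((hb 0).mul (hp 0)) ((hb 1).mul (hp 1)), pd_mul (hb 0) (hp 0),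
      pd_mul (hb 1) (hp 1), pd_mul contDiff_const ((hb i).mul hS), pd_const,
      pd_mul (hb i) hS, pd_add ((hp 0).mul (hp 0)) ((hp 1).mul (hp 1)),
      pd_mul (hp 0) (hp 0), pd_mul (hp 1) (hp 1)]
    ring
  have hquad (x : E2) : ((Λ x).mulVec (grad2 φ x)) ⬝ᵥ grad2 φ x =
      -(pd 0 (fun y => ub y 0) x * pd 0 φ x ^ 2
        + (pd 1 (fun y => ub y 0) x + pd 0 (fun y => ub y 1) x) * (pd 0 φ x * pd 1 φ x)
        + pd 1 (fun y => ub y 1) x * pd 1 φ x ^ 2)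
      + 1 / 2 * (pd 0 (fun y => ub y 0) x + pd 1 (fun y => ub y 1) x)
        * (pd 0 φ x ^ 2 + pd 1 φ x ^ 2)
      + 1 / (2 * ν) * (u' x 0 * pd 0 φ x + u' x 1 * pd 1 φ x) ^ 2 := by
    rw [hΛ x]
    simp [Matrix.mulVec, dotProduct, Fin.sum_univ_two, gradMat, grad2, divg, Matrix.vecMulVec_apply]
    ring
  have hQ : Integrable fun x => ((Λ x).mulVec (grad2 φ x)) ⬝ᵥ grad2 φ x := by
    refine hint ?_ fun x hx => by rw [hquad]; simp [hp0 hx]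
    simp only [hquad]
    fun_prop
  have hL2 : Integrable fun x => lap φ x ^ 2 :=
    hint (hlap.pow 2) fun x hx => by simp [hlap0 hx]
  have hL : Integrable fun x => (∑ i, u x i * pd i φ x) * lap φ x := by
    refine hint ?_ fun x hx => by simp [hlap0 hx]
    simp only [hu, Pi.add_apply]
    fun_prop
  have hdiv : Integrable fun x => pd 0 (F 0) x + pd 1 (F 1) x := (hFi 0).1.add (hFi 1).1
  have hdivQ : Integrable fun x => (pd 0 (F 0) x + pd 1 (F 1) x)
      + ((Λ x).mulVec (grad2 φ x)) ⬝ᵥ grad2 φ x := hdiv.add hQ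
  calc ∫ x, (∑ i, u x i * pd i φ x) * lap φ x
      ≤ ∫ x, ((pd 0 (F 0) x + pd 1 (F 1) x) + ((Λ x).mulVec (grad2 φ x)) ⬝ᵥ grad2 φ x)
          + ν / 2 * lap φ x ^ 2 := by
        refine integral_mono hL (hdivQ.add (hL2.const_mul _)) fun x => ?_
        have young (s t : ℝ) : s * t ≤ 1 / (2 * ν) * s ^ 2 + ν / 2 * t ^ 2 := by
          have h : 1 / (2 * ν) * s ^ 2 + ν / 2 * t ^ 2 - s * t
              = 1 / (2 * ν) * (s - ν * t) ^ 2 := by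
            field_simp
            ring
          have : 0 ≤ 1 / (2 * ν) * (s - ν * t) ^ 2 := by positivity
          linarith
        have hy := young (u' x 0 * pd 0 φ x + u' x 1 * pd 1 φ x) (lap φ x)
        simp only [hquad, hpdF, hu, Fin.sum_univ_two, Pi.add_apply, pd_comm hφ 1 0 x]
        simp only [lap] at hy ⊢
        linarith
    _ = _ := by
        rw [integral_add hdivQ (hL2.const_mul _), integral_add hdiv hQ,
          integral_add (hFi 0).1 (hFi 1).1, (hFi 0).2, (hFi 1).2, integral_const_mul]
        ring
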